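/- arXiv:math/0406423 — 2 statements merged into one kernel-verified Lean document; each statement's English description precedes it below -/
import Mathlib

section
/- Let T be a random variable with values in {0,1,2,...} having non-increasing weights, i.e. P(T = k) ≥ P(T = k+1) for every k ≥ 0. Then (E[T])² ≤ (3/4)·E[T²], and consequently (E[T])² ≤ 3·Var(T). -/
open MeasureTheory ProbabilityTheory ENNReal

lemma aux_poly (c : ℝ) (n : ℕ) :
    ∑ k ∈ Finset.range (n+1), (3/4*(k:ℝ)^2 - 2*c*k + c^2)
      = (n+1) * ((c - n/2)^2 + n/8) := by
  induction n with
  | zero => simp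
  | succ n ih => rw [Finset.sum_range_succ, ih]; push_cast; ring

lemma aux_abel (p f : ℕ → ℝ) (hp : ∀ k, p (k+1) ≤ p k)
    (hS : ∀ n, 0 ≤ ∑ k ∈ Finset.range (n+1), f k) (n : ℕ) :
    p n * ∑ k ∈ Finset.range (n+1), f k ≤ ∑ k ∈ Finset.range (n+1), p k * f k := by
  induction n with
  | zero => simp
  | succ n ih =>
    rw [Finset.sum_range_succ, Finset.sum_range_succ (fun k => p k * f k)]
    nlinarith [mul_le_mul_of_nonneg_right (hp n) (hS n)]

lemma aux_integral (μ : Measure ℕ) [IsProbabilityMeasure μ]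
    (hmono : ∀ k : ℕ, μ.real {k+1} ≤ μ.real {k}) (c : ℝ)
    (hi : Integrable (fun k : ℕ => 3/4*(k:ℝ)^2 - 2*c*k + c^2) μ) :
    0 ≤ ∫ k : ℕ, (3/4*(k:ℝ)^2 - 2*c*k + c^2) ∂μ := by
  rw [integral_countable' hi]
  by_cases hs : Summable (fun k : ℕ => μ.real {k} • (3/4*(k:ℝ)^2 - 2*c*k + c^2))
  · refine ge_of_tendsto (hs.hasSum.tendsto_sum_nat.comp (Filter.tendsto_add_atTop_nat 1))
      (Filter.Eventually.of_forall fun n => ?_)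
    have hS : ∀ n : ℕ, 0 ≤ ∑ k ∈ Finset.range (n+1), (3/4*(k:ℝ)^2 - 2*c*k + c^2) := by
      intro n; rw [aux_poly]; positivity
    exact le_trans (mul_nonneg measureReal_nonneg (hS n))
      (aux_abel (fun k => μ.real {k}) _ hmono hS n)
  · rw [tsum_eq_zero_of_not_summable hs]

/-- If `T` is a random variable with values in `{0,1,2,...}` having
non-increasing weights, then `(E T)^2 ≤ (3/4) E T²` and consequently `(E T)^2 ≤ 3 Var T`. -/
theorem stmt6 {Ω : Type*} [MeasurableSpace Ω] (P : Measure Ω) [IsProbabilityMeasure P]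
    (T : Ω → ℕ) (hT : Measurable T)
    (hmono : ∀ k : ℕ, P {ω | T ω = k + 1} ≤ P {ω | T ω = k}) :
    (∫⁻ ω, (T ω : ℝ≥0∞) ∂P) ^ 2 ≤ (3 / 4 : ℝ≥0∞) * ∫⁻ ω, (T ω : ℝ≥0∞) ^ 2 ∂P ∧
      (∫⁻ ω, (T ω : ℝ≥0∞) ∂P) ^ 2 ≤ 3 * evariance (fun ω => (T ω : ℝ)) P := by
  have hm : Measurable (fun ω => (T ω : ℝ)) := measurable_from_nat.comp hT
  have hsq : ∀ ω, (T ω : ℝ≥0∞)^2 = ENNReal.ofReal ((T ω : ℝ)^2) := fun ω => by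
    rw [ENNReal.ofReal_pow (by positivity), ENNReal.ofReal_natCast]
  by_cases hL : MemLp (fun ω => (T ω : ℝ)) 2 P
  · have hi1 : Integrable (fun ω => (T ω : ℝ)) P := hL.integrable (by norm_num)
    have hi2 : Integrable (fun ω => (T ω : ℝ)^2) P := hL.integrable_sq
    have e1 : ∫⁻ ω, (T ω : ℝ≥0∞) ∂P = ENNReal.ofReal (∫ ω, (T ω : ℝ) ∂P) := by
      rw [ofReal_integral_eq_lintegral_ofReal hi1 (Filter.Eventually.of_forall fun ω => by positivity)]
      simp
    have e2 : ∫⁻ ω, (T ω : ℝ≥0∞)^2 ∂P = ENNReal.ofReal (∫ ω, (T ω : ℝ)^2 ∂P) := by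
      rw [ofReal_integral_eq_lintegral_ofReal hi2 (Filter.Eventually.of_forall fun ω => by positivity)]
      simp only [hsq]
    have h0 : 0 ≤ ∫ ω, (T ω : ℝ) ∂P := integral_nonneg fun ω => by positivity
    have key : (∫ ω, (T ω : ℝ) ∂P)^2 ≤ 3/4 * ∫ ω, (T ω : ℝ)^2 ∂P := by
      set c := ∫ ω, (T ω : ℝ) ∂P with hc
      have := Measure.isProbabilityMeasure_map (μ := P) hT.aemeasurable
      have hJ : Integrable (fun ω => 3/4*(T ω:ℝ)^2 - 2*c*(T ω)) P :=
        (hi2.const_mul _).sub (hi1.const_mul _)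
      have hI : Integrable (fun ω => 3/4*(T ω:ℝ)^2 - 2*c*(T ω) + c^2) P :=
        hJ.add (integrable_const _)
      have h := aux_integral (P.map T) (fun k => by
        simp only [Measure.real]
        rw [Measure.map_apply hT (measurableSet_singleton _),
          Measure.map_apply hT (measurableSet_singleton _)]
        exact ENNReal.toReal_mono (measure_ne_top _ _) (hmono k)) c
        ((integrable_map_measure (measurable_from_nat.aestronglyMeasurable) hT.aemeasurable).2 hI)
      rw [integral_map hT.aemeasurable measurable_from_nat.aestronglyMeasurable,
        integral_add hJ (integrable_const _),
        integral_sub (hi2.const_mul _) (hi1.const_mul _), integral_const_mul,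
        integral_const_mul, ← hc] at h
      simp at h
      nlinarith
    have e34 : (3/4 : ℝ≥0∞) = ENNReal.ofReal (3/4) := by
      rw [ENNReal.ofReal_div_of_pos (by norm_num)]; norm_num
    have e3 : (3 : ℝ≥0∞) = ENNReal.ofReal 3 := by norm_num
    constructor
    · rw [e1, e2, e34, ← ENNReal.ofReal_pow h0, ← ENNReal.ofReal_mul (by norm_num)]
      exact ENNReal.ofReal_le_ofReal key
    · rw [e1, ← hL.ofReal_variance_eq, e3, ← ENNReal.ofReal_pow h0,
        ← ENNReal.ofReal_mul (by norm_num), variance_eq_sub hL]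
      apply ENNReal.ofReal_le_ofReal
      simp only [Pi.pow_apply]
      linarith
  · constructor
    · have : ∫⁻ ω, (T ω : ℝ≥0∞)^2 ∂P = ⊤ := by
        by_contra hne
        apply hL
        rw [memLp_two_iff_integrable_sq hm.aestronglyMeasurable]
        refine ⟨(hm.pow_const 2).aestronglyMeasurable, ?_⟩
        rw [hasFiniteIntegral_iff_ofReal (Filter.Eventually.of_forall fun ω => by positivity)]
        simp only [hsq] at hne
        exact lt_top_iff_ne_top.2 hne
      rw [this, ENNReal.mul_top (by simp)]
      exact le_top
    · rw [evariance_eq_top hm.aestronglyMeasurable hL, ENNReal.mul_top (by simp)]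
      exact le_top
end

section
/- If μ and ν are two symmetric unimodal probability distributions on ℤ, then their convolution μ * ν is again symmetric unimodal on ℤ. -/
open MeasureTheory ProbabilityTheory

lemma conv_singleton_int (μ ν : Measure ℤ) [IsProbabilityMeasure μ] [IsProbabilityMeasure ν]
    (n : ℤ) : (μ.conv ν) {n} = ∑' i : ℤ, μ {n - i} * ν {i} := by
  rw [Measure.conv, Measure.map_apply (by fun_prop) (measurableSet_singleton n),
    Measure.prod_apply_symm ((by fun_prop : Measurable fun x : ℤ × ℤ => x.1 + x.2)
      (measurableSet_singleton n)), lintegral_countable']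
  refine tsum_congr fun i => ?_
  congr 2
  ext x
  simp
  omega

/-- The convolution of two symmetric unimodal probability distributions
on `ℤ` is again symmetric unimodal. -/
theorem stmt12 (μ ν : Measure ℤ) [IsProbabilityMeasure μ] [IsProbabilityMeasure ν]
    (hμsymm : ∀ k : ℤ, μ {k} = μ {-k}) (hνsymm : ∀ k : ℤ, ν {k} = ν {-k})
    (hμuni : ∀ k : ℕ, μ {(k : ℤ) + 1} ≤ μ {(k : ℤ)})
    (hνuni : ∀ k : ℕ, ν {(k : ℤ) + 1} ≤ ν {(k : ℤ)}) :
    (∀ k : ℤ, (μ.conv ν) {k} = (μ.conv ν) {-k}) ∧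
      (∀ k : ℕ, (μ.conv ν) {(k : ℤ) + 1} ≤ (μ.conv ν) {(k : ℤ)}) := by
  constructor
  · intro k
    rw [conv_singleton_int, conv_singleton_int, ← (Equiv.neg ℤ).tsum_eq]
    refine tsum_congr fun i => ?_
    rw [Equiv.neg_apply, hμsymm, ← hνsymm]
    congr 3
    ring
  · intro k
    have hanti : Antitone fun n : ℕ => μ {(n : ℤ)} :=
      antitone_nat_of_succ_le fun n => by simpa using hμuni n
    have habs : ∀ z : ℤ, μ {z} = μ {(z.natAbs : ℤ)} := by
      intro z
      rcases Int.natAbs_eq z with h | h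
      · rw [← h]
      · rw [hμsymm z]; congr 2; omega
    rw [conv_singleton_int, conv_singleton_int, ← (Equiv.addRight (1 : ℤ)).tsum_eq,
      tsum_of_nat_of_neg_add_one ENNReal.summable ENNReal.summable,
      tsum_of_nat_of_neg_add_one ENNReal.summable ENNReal.summable,
      ← ENNReal.tsum_add, ← ENNReal.tsum_add]
    refine ENNReal.tsum_le_tsum fun i => ?_
    simp only [Equiv.coe_addRight]
    have e1 : (k : ℤ) + 1 - (i + 1) = k - i := by ring
    have e2 : (k : ℤ) + 1 - (-((i : ℤ) + 1) + 1) = k + 1 + i := by ring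
    have e3 : (k : ℤ) - (-((i : ℤ) + 1)) = k + 1 + i := by ring
    have e4 : -((i : ℤ) + 1) + 1 = -i := by ring
    rw [e1, e2, e3, e4, ← hνsymm, ← hνsymm]
    have hxy : μ {(k : ℤ) + 1 + i} ≤ μ {(k : ℤ) - i} := by
      rw [habs, habs (k - i)]
      exact hanti (by omega)
    obtain ⟨d, hd⟩ := exists_add_of_le (hνuni i)
    rw [hd, mul_add, mul_add]
    calc _ = μ {(k : ℤ) - i} * ν {(i : ℤ) + 1} + μ {(k : ℤ) + 1 + i} * ν {(i : ℤ) + 1}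
          + μ {(k : ℤ) + 1 + i} * d := by ring
      _ ≤ μ {(k : ℤ) - i} * ν {(i : ℤ) + 1} + μ {(k : ℤ) + 1 + i} * ν {(i : ℤ) + 1}
          + μ {(k : ℤ) - i} * d := by gcongr
      _ = _ := by ring
end
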